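/- arXiv:2107.10138 — 2 statements merged into one kernel-verified Lean document; each statement's English description precedes it below -/
import Mathlib

section
/- Let U₁, U₂, U₃, U₄ be independent random variables, each uniformly distributed on the interval [0,1). Then the random variable log(1 − U₁)·cos(π·U₂) + log(1 − U₃)·cos(π·U₄) is distributed according to the standard Laplace distribution Lap(0,1). Equivalently, the pushforward of the four-fold product of the uniform measure on [0,1) under the map (u₁,u₂,u₃,u₄) ↦ log(1−u₁)·cos(π·u₂) + log(1−u₃)·cos(π·u₄) equals the standard Laplace measure. -/
open MeasureTheory ProbabilityTheory Real

/-- The standard Laplace distribution `Lap(0,1)`: the measure on `ℝ` with density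
`(1/2) exp (-|x|)` with respect to Lebesgue measure. -/
noncomputable def laplaceMeasure : Measure ℝ :=
  volume.withDensity fun x => ENNReal.ofReal ((1 / 2) * Real.exp (-|x|))

lemma integrable_exp_neg_abs : Integrable fun x : ℝ => Real.exp (-|x|) := by
  rw [← integrableOn_univ, ← Set.Iic_union_Ioi (a := (0 : ℝ))]
  refine IntegrableOn.union ?_ ?_
  · refine (integrableOn_exp_mul_Iic one_pos 0).congr_fun (fun x hx => ?_) measurableSet_Iic
    simp [abs_of_nonpos (Set.mem_Iic.1 hx)]
  · refine (integrableOn_exp_neg_Ioi 0).congr_fun (fun x hx => ?_) measurableSet_Ioi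
    simp [abs_of_pos (Set.mem_Ioi.1 hx)]

instance isFiniteMeasure_laplaceMeasure : IsFiniteMeasure laplaceMeasure :=
  isFiniteMeasure_withDensity_ofReal (integrable_exp_neg_abs.const_mul (1 / 2)).2

lemma charFun_laplaceMeasure (t : ℝ) :
    charFun laplaceMeasure t = ((1 / (1 + t ^ 2) : ℝ) : ℂ) := by
  have hneg : Set.EqOn
      (fun x : ℝ => (ENNReal.ofReal ((1 / 2) * Real.exp (-|x|))).toReal •
        Complex.exp (t * x * Complex.I))
      (fun x : ℝ => (1 / 2 : ℂ) * Complex.exp ((1 + t * Complex.I) * x)) (Set.Iic 0) := by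
    intro x hx
    simp only
    rw [ENNReal.toReal_ofReal (by positivity), abs_of_nonpos hx, Complex.real_smul]
    push_cast
    rw [mul_assoc, ← Complex.exp_add]
    ring_nf
  have hpos : Set.EqOn
      (fun x : ℝ => (ENNReal.ofReal ((1 / 2) * Real.exp (-|x|))).toReal •
        Complex.exp (t * x * Complex.I))
      (fun x : ℝ => (1 / 2 : ℂ) * Complex.exp ((-1 + t * Complex.I) * x)) (Set.Ioi 0) := by
    intro x hx
    simp only
    rw [ENNReal.toReal_ofReal (by positivity), abs_of_pos hx, Complex.real_smul]
    push_cast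
    rw [mul_assoc, ← Complex.exp_add]
    ring_nf
  have hre₁ : 0 < (1 + t * Complex.I : ℂ).re := by simp
  have hre₂ : (-1 + t * Complex.I : ℂ).re < 0 := by simp
  have h₁ : (1 + t * Complex.I : ℂ) ≠ 0 := fun h => by simp [h] at hre₁
  have h₂ : (-1 + t * Complex.I : ℂ) ≠ 0 := fun h => by simp [h] at hre₂
  have h₃ : (1 + t ^ 2 : ℂ) ≠ 0 := by
    have : (1 + t ^ 2 : ℝ) ≠ 0 := by positivity
    exact_mod_cast this
  rw [charFun_apply_real, laplaceMeasure, integral_withDensity_eq_integral_toReal_smul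
    (by fun_prop) (ae_of_all _ fun _ => ENNReal.ofReal_lt_top), ← setIntegral_univ,
    ← Set.Iic_union_Ioi (a := (0 : ℝ)),
    setIntegral_union (Set.Iic_disjoint_Ioi le_rfl) measurableSet_Ioi
      (IntegrableOn.congr_fun ((integrableOn_exp_mul_complex_Iic hre₁ 0).const_mul _) hneg.symm
        measurableSet_Iic)
      (IntegrableOn.congr_fun ((integrableOn_exp_mul_complex_Ioi hre₂ 0).const_mul _) hpos.symm
        measurableSet_Ioi),
    setIntegral_congr_fun measurableSet_Iic hneg, setIntegral_congr_fun measurableSet_Ioi hpos,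
    integral_const_mul, integral_const_mul, integral_exp_mul_complex_Iic hre₁,
    integral_exp_mul_complex_Ioi hre₂]
  simp only [Complex.ofReal_zero, mul_zero, Complex.exp_zero]
  push_cast
  field_simp
  linear_combination (-2 * t ^ 2 : ℂ) * Complex.I_sq

/-- The characteristic function of `log (1 - U)` for `U` uniform on `[0,1)`. -/
lemma setIntegral_exp_log_one_sub (s : ℝ) :
    ∫ u in Set.Ico (0 : ℝ) 1, Complex.exp (s * Real.log (1 - u) * Complex.I)
      = 1 / (1 + s * Complex.I) := by
  rw [integral_Ico_eq_integral_Ioc, ← intervalIntegral.integral_of_le zero_le_one,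
    intervalIntegral.integral_comp_sub_left
      (fun x : ℝ => Complex.exp (s * Real.log x * Complex.I)) 1]
  have hcongr : ∫ x in (1 - 1 : ℝ)..1 - 0, Complex.exp (s * Real.log x * Complex.I)
      = ∫ x in (0 : ℝ)..1, (x : ℂ) ^ (s * Complex.I) := by
    rw [sub_self, sub_zero]
    refine intervalIntegral.integral_congr_ae (ae_of_all _ fun x hx => ?_)
    rw [Set.uIoc_of_le zero_le_one] at hx
    rw [Complex.cpow_def_of_ne_zero (by exact_mod_cast hx.1.ne'), Complex.ofReal_log hx.1.le]
    ring_nf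
  have hne : (s * Complex.I + 1 : ℂ) ≠ 0 := fun h => by
    have := congrArg Complex.re h
    simp at this
  rw [hcongr, integral_cpow (Or.inl (by simp))]
  simp [Complex.zero_cpow hne, add_comm]

lemma one_add_mul_cos_sq_pos (t v : ℝ) : 0 < 1 + t ^ 2 * Real.cos (π * v) ^ 2 := by positivity

lemma integral_inv_one_add_mul_cos_sq (t : ℝ) :
    ∫ v in (0 : ℝ)..1, 1 / (1 + t ^ 2 * Real.cos (π * v) ^ 2) = 1 / √(1 + t ^ 2) := by
  set s := √(1 + t ^ 2)
  have hs0 : 0 < s := Real.sqrt_pos.2 (by positivity)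
  have hs2 : s ^ 2 = 1 + t ^ 2 := Real.sq_sqrt (by positivity)
  let F : ℝ → ℝ := fun v => (v + arctan ((1 - s) * (sin (π * v) * cos (π * v)) /
    (s * cos (π * v) ^ 2 + sin (π * v) ^ 2)) / π) / s
  have hF : ∀ v, HasDerivAt F (1 / (1 + t ^ 2 * Real.cos (π * v) ^ 2)) v := by
    intro v
    have hv : HasDerivAt (fun v : ℝ => π * v) π v := by
      simpa using (hasDerivAt_id v).const_mul π
    have hsin := hv.sin
    have hcos := hv.cos
    have hSC := Real.sin_sq_add_cos_sq (π * v)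
    have hD : s * cos (π * v) ^ 2 + sin (π * v) ^ 2 ≠ 0 := by
      rcases eq_or_ne (cos (π * v)) 0 with h | h
      · rw [h] at hSC ⊢
        nlinarith
      · positivity
    have hquot := ((hsin.mul hcos).const_mul (1 - s)).div
      (((hcos.pow 2).const_mul s).add (hsin.pow 2)) hD
    refine (((hasDerivAt_id v).add (hquot.arctan.div_const π)).div_const s).congr_deriv ?_
    have hpos := (one_add_mul_cos_sq_pos t v).ne'
    simp only [Pi.mul_apply, Pi.add_apply, Pi.pow_apply, Pi.div_apply]
    generalize sin (π * v) = S at *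
    generalize cos (π * v) = C at *
    have hND : (s * C ^ 2 + S ^ 2) ^ 2 + ((1 - s) * (S * C)) ^ 2 = 1 + t ^ 2 * C ^ 2 := by
      have : S ^ 2 = 1 - C ^ 2 := by linarith
      rw [mul_pow, mul_pow, this, ← sub_eq_zero]
      linear_combination C ^ 2 * hs2
    have hone : 1 + ((1 - s) * (S * C) / (s * C ^ 2 + S ^ 2)) ^ 2
        = (1 + t ^ 2 * C ^ 2) / (s * C ^ 2 + S ^ 2) ^ 2 := by
      rw [← hND]
      field_simp
    rw [hone]
    have hπ := Real.pi_ne_zero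
    have hD' : C ^ 2 * s + S ^ 2 ≠ 0 := by rwa [mul_comm]
    field_simp
    norm_num only [pow_one, Nat.cast_ofNat]
    linear_combination ((1 - s) * (s * C ^ 2 - S ^ 2) + s - 1) * hSC - C ^ 2 * hs2
  rw [intervalIntegral.integral_eq_sub_of_hasDerivAt (fun v _ => hF v)]
  · simp [F]
  · refine Continuous.intervalIntegrable ?_ _ _
    exact Continuous.div (by fun_prop) (by fun_prop) fun v => (one_add_mul_cos_sq_pos t v).ne'

lemma one_add_ofReal_mul_I_ne_zero (x : ℝ) : (1 + x * Complex.I : ℂ) ≠ 0 := fun h => by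
  have := congrArg Complex.re h
  simp at this

lemma integral_inv_one_add_mul_cos_mul_I (t : ℝ) :
    ∫ v in (0 : ℝ)..1, 1 / (1 + ((t * Real.cos (π * v) : ℝ) : ℂ) * Complex.I)
      = ((1 / √(1 + t ^ 2) : ℝ) : ℂ) := by
  set f : ℝ → ℂ := fun v => 1 / (1 + ((t * Real.cos (π * v) : ℝ) : ℂ) * Complex.I) with hf
  have hcont : Continuous f :=
    Continuous.div (by fun_prop) (by fun_prop) fun v => one_add_ofReal_mul_I_ne_zero _
  have hreflect : ∫ v in (0 : ℝ)..1, f (1 - v) = ∫ v in (0 : ℝ)..1, f v := by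
    simp
  have hsum : ∀ v, f v + f (1 - v)
      = 2 * ((1 / (1 + t ^ 2 * Real.cos (π * v) ^ 2) : ℝ) : ℂ) := by
    intro v
    have hcos : Real.cos (π * (1 - v)) = -Real.cos (π * v) := by
      rw [mul_sub, mul_one, Real.cos_pi_sub]
    simp only [hf, hcos, mul_neg]
    have h₁ := one_add_ofReal_mul_I_ne_zero (t * Real.cos (π * v))
    have h₂ := one_add_ofReal_mul_I_ne_zero (-(t * Real.cos (π * v)))
    have h₃ : ((1 + t ^ 2 * Real.cos (π * v) ^ 2 : ℝ) : ℂ) ≠ 0 :=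
      Complex.ofReal_ne_zero.2 (one_add_mul_cos_sq_pos t v).ne'
    generalize Real.cos (π * v) = C at *
    push_cast at h₁ h₂ h₃ ⊢
    rw [div_add_div _ _ h₁ h₂, mul_one_div, div_eq_div_iff (mul_ne_zero h₁ h₂) h₃]
    linear_combination (2 * t ^ 2 * C ^ 2 : ℂ) * Complex.I_sq
  have htwo : 2 * ∫ v in (0 : ℝ)..1, f v = 2 * ((1 / √(1 + t ^ 2) : ℝ) : ℂ) := by
    rw [two_mul]
    nth_rewrite 2 [← hreflect]
    rw [← intervalIntegral.integral_add (hcont.intervalIntegrable _ _)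
      (Continuous.intervalIntegrable (by fun_prop) _ _)]
    simp_rw [hsum]
    rw [intervalIntegral.integral_const_mul, intervalIntegral.integral_ofReal,
      integral_inv_one_add_mul_cos_sq]
  exact mul_left_cancel₀ two_ne_zero htwo

instance isProbabilityMeasure_restrict_Ico_zero_one :
    IsProbabilityMeasure (volume.restrict (Set.Ico (0 : ℝ) 1)) := ⟨by simp⟩

/-- The characteristic function of `log (1 - U) * cos (π V)` for independent `U`, `V` uniform
on `[0,1)`. -/
lemma charFun_map_log_mul_cos (t : ℝ) :
    charFun (((volume.restrict (Set.Ico (0 : ℝ) 1)).prod (volume.restrict (Set.Ico 0 1))).map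
      fun p : ℝ × ℝ => Real.log (1 - p.1) * Real.cos (π * p.2)) t
      = ((1 / √(1 + t ^ 2) : ℝ) : ℂ) := by
  rw [charFun_apply_real, integral_map (by fun_prop) (by fun_prop), integral_prod_symm]
  · have hinner : ∀ v : ℝ, ∫ u in Set.Ico (0 : ℝ) 1,
        Complex.exp (t * ((Real.log (1 - u) * Real.cos (π * v) : ℝ) : ℂ) * Complex.I)
        = 1 / (1 + ((t * Real.cos (π * v) : ℝ) : ℂ) * Complex.I) := by
      intro v
      rw [← setIntegral_exp_log_one_sub]
      congr with u
      push_cast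
      ring_nf
    simp_rw [hinner]
    rw [integral_Ico_eq_integral_Ioc, ← intervalIntegral.integral_of_le zero_le_one,
      integral_inv_one_add_mul_cos_mul_I]
  · refine (integrable_const (1 : ℝ)).mono (by fun_prop) (ae_of_all _ fun p => ?_)
    rw [← Complex.ofReal_mul, Complex.norm_exp_ofReal_mul_I]
    simp

/-- If `U₁, U₂, U₃, U₄` are independent uniform random variables on `[0,1)`, then
`log (1 - U₁) * cos (π U₂) + log (1 - U₃) * cos (π U₄)` has the standard Laplace
distribution: the pushforward of the four-fold product of the uniform measure on `[0,1)`
under this map is the standard Laplace measure. -/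
theorem laplace_from_four_uniforms :
    Measure.map
      (fun u : Fin 4 → ℝ =>
        Real.log (1 - u 0) * Real.cos (π * u 1) + Real.log (1 - u 2) * Real.cos (π * u 3))
      (Measure.pi fun _ : Fin 4 => volume.restrict (Set.Ico 0 1))
      = laplaceMeasure := by
  set μ : Measure ℝ := volume.restrict (Set.Ico 0 1)
  set P : Measure (Fin 4 → ℝ) := Measure.pi fun _ => μ
  let g : ℝ × ℝ → ℝ := fun p => Real.log (1 - p.1) * Real.cos (π * p.2)
  have hg : Measurable g := by fun_prop
  have hindep : iIndepFun (fun (i : Fin 4) (u : Fin 4 → ℝ) => u i) P :=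
    iIndepFun_pi (X := fun _ => id) fun _ => aemeasurable_id
  have hpair : ∀ i j : Fin 4, i ≠ j → P.map (fun u => (u i, u j)) = μ.prod μ := by
    intro i j hij
    rw [(hindep.indepFun hij).map_prod_eq_prod_map_map
      (measurable_pi_apply i).aemeasurable (measurable_pi_apply j).aemeasurable]
    exact congrArg₂ Measure.prod (measurePreserving_eval (fun _ : Fin 4 => μ) i).map_eq
      (measurePreserving_eval (fun _ : Fin 4 => μ) j).map_eq
  have hchar : ∀ i j : Fin 4, i ≠ j → ∀ t,
      charFun (P.map fun u => g (u i, u j)) t = ((1 / √(1 + t ^ 2) : ℝ) : ℂ) := by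
    intro i j hij t
    rw [← charFun_map_log_mul_cos, ← hpair i j hij, Measure.map_map hg (by fun_prop)]
    rfl
  have hadd := ((hindep.indepFun_prodMk_prodMk (fun i => measurable_pi_apply i) 0 1 2 3
    (by decide) (by decide) (by decide) (by decide)).comp hg hg).charFun_map_add_eq_mul
      (by fun_prop) (by fun_prop)
  refine Measure.ext_of_charFun (funext fun t => ?_)
  refine (congrFun hadd t).trans ?_
  rw [Pi.mul_apply]
  refine (congrArg₂ (· * ·) (hchar 0 1 (by decide) t) (hchar 2 3 (by decide) t)).trans ?_
  rw [charFun_laplaceMeasure, ← Complex.ofReal_mul, div_mul_div_comm, one_mul,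
    Real.mul_self_sqrt (by positivity)]
end

section
/- Let U₁ and U₂ be independent random variables, each uniformly distributed on the interval [0,1). Then the random variable √(−2·log(1 − U₁))·cos(2π·U₂) is distributed according to the standard Gaussian distribution N(0,1); that is, the pushforward of the product of the two uniform measures under the map (u₁,u₂) ↦ √(−2·log(1−u₁))·cos(2π·u₂) equals the standard Gaussian measure (Box–Muller transform). -/
open MeasureTheory ProbabilityTheory Real

open scoped ENNReal

/-- The substitution `u = 1 - exp (-r² / 2)`, which inverts `r = √(-2 log (1 - u))`. -/
lemma setLIntegral_comp_sqrt_neg_two_mul_log (F : ℝ → ℝ≥0∞) :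
    ∫⁻ u in Set.Ioo 0 1, F (√(-2 * log (1 - u)))
      = ∫⁻ r in Set.Ioi 0, ENNReal.ofReal (r * exp (-r ^ 2 / 2)) * F r := by
  have himage : (fun r : ℝ => 1 - exp (-r ^ 2 / 2)) '' Set.Ioi 0 = Set.Ioo 0 1 := by
    ext u
    simp only [Set.mem_image, Set.mem_Ioi, Set.mem_Ioo]
    constructor
    · rintro ⟨r, hr, rfl⟩
      have h : exp (-r ^ 2 / 2) < 1 := exp_lt_one_iff.2 (by nlinarith)
      exact ⟨by linarith, by linarith [exp_pos (-r ^ 2 / 2)]⟩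
    · rintro ⟨h0, h1⟩
      have hlog : log (1 - u) < 0 := log_neg (by linarith) (by linarith)
      refine ⟨√(-2 * log (1 - u)), sqrt_pos.2 (by linarith), ?_⟩
      rw [sq_sqrt (by linarith), show -(-2 * log (1 - u)) / 2 = log (1 - u) by ring,
        exp_log (by linarith)]
      ring
  have hsqrt : ∀ r ∈ Set.Ioi (0 : ℝ), √(-2 * log (1 - (1 - exp (-r ^ 2 / 2)))) = r := by
    intro r hr
    rw [sub_sub_cancel, log_exp, show -2 * (-r ^ 2 / 2) = r ^ 2 by ring, sqrt_sq (le_of_lt hr)]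
  have hinj : Set.InjOn (fun r : ℝ => 1 - exp (-r ^ 2 / 2)) (Set.Ioi 0) :=
    Set.LeftInvOn.injOn (f₁' := fun u => √(-2 * log (1 - u))) hsqrt
  have hderiv : ∀ r ∈ Set.Ioi (0 : ℝ), HasDerivWithinAt (fun r : ℝ => 1 - exp (-r ^ 2 / 2))
      (r * exp (-r ^ 2 / 2)) (Set.Ioi 0) r := by
    intro r _
    have h : HasDerivAt (fun r : ℝ => -r ^ 2 / 2) (-r) r := by
      refine ((hasDerivAt_pow 2 r).neg.div_const 2).congr_deriv ?_
      norm_num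
      ring
    refine (h.exp.const_sub 1).hasDerivWithinAt.congr_deriv ?_
    ring
  rw [← himage, lintegral_image_eq_lintegral_abs_deriv_mul measurableSet_Ioi hderiv hinj]
  refine setLIntegral_congr_fun measurableSet_Ioi fun r hr => ?_
  have hr' : (0 : ℝ) < r := hr
  simp only [hsqrt r hr]
  rw [abs_of_pos (by positivity)]

/-- The substitution `θ = 2 π u - π`. -/
lemma setLIntegral_Ioo_neg_pi_pi (G : ℝ → ℝ≥0∞) :
    ∫⁻ θ in Set.Ioo (-π) π, G θ
      = ENNReal.ofReal (2 * π) * ∫⁻ u in Set.Ioo 0 1, G (2 * π * u - π) := by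
  have himage : (fun u : ℝ => 2 * π * u - π) '' Set.Ioo 0 1 = Set.Ioo (-π) π := by
    have h := Set.image_affine_Ioo (a := 2 * π) (by positivity) (-π) 0 1
    simp only [← sub_eq_add_neg] at h
    rw [h]
    congr 1 <;> ring
  have hderiv : ∀ u ∈ Set.Ioo (0 : ℝ) 1,
      HasDerivWithinAt (fun u : ℝ => 2 * π * u - π) (2 * π) (Set.Ioo 0 1) u := fun u _ =>
    ((hasDerivAt_const_mul (2 * π)).sub_const π).hasDerivWithinAt
  have hinj : Set.InjOn (fun u : ℝ => 2 * π * u - π) (Set.Ioo 0 1) := by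
    intro a _ b _ hab
    exact mul_left_cancel₀ (by positivity : 2 * π ≠ 0) (sub_left_injective hab)
  rw [← himage, lintegral_image_eq_lintegral_abs_deriv_mul measurableSet_Ioo hderiv hinj,
    abs_of_pos (by positivity), lintegral_const_mul' _ _ ENNReal.ofReal_ne_top]

lemma gaussianPDF_mul_gaussianPDF_polar (r θ : ℝ) :
    gaussianPDF 0 1 (r * cos θ) * gaussianPDF 0 1 (r * sin θ)
      = ENNReal.ofReal ((2 * π)⁻¹ * exp (-r ^ 2 / 2)) := by
  rw [gaussianPDF, gaussianPDF, ← ENNReal.ofReal_mul (gaussianPDFReal_nonneg _ _ _)]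
  congr 1
  simp only [gaussianPDFReal, NNReal.coe_one, mul_one, sub_zero]
  rw [mul_mul_mul_comm, ← exp_add, ← mul_inv, mul_self_sqrt (by positivity)]
  congr 2
  linear_combination (-r ^ 2 / 2) * cos_sq_add_sin_sq θ

/-- Integration against the standard Gaussian, in polar coordinates. -/
lemma lintegral_gaussianReal_eq_polar {f : ℝ → ℝ≥0∞} (hf : Measurable f) :
    ∫⁻ x, f x ∂gaussianReal 0 1
      = ∫⁻ r in Set.Ioi 0, ∫⁻ θ in Set.Ioo (-π) π,
          ENNReal.ofReal (r * exp (-r ^ 2 / 2)) * (ENNReal.ofReal (2 * π)⁻¹ * f (r * cos θ)) := by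
  have hpdf : Measurable (gaussianPDF 0 1) := measurable_gaussianPDF 0 1
  calc ∫⁻ x, f x ∂gaussianReal 0 1
      = ∫⁻ x, ∫⁻ y, f x * (gaussianPDF 0 1 x * gaussianPDF 0 1 y) := by
        rw [gaussianReal_of_var_ne_zero 0 one_ne_zero,
          lintegral_withDensity_eq_lintegral_mul _ hpdf hf]
        refine lintegral_congr fun x => ?_
        simp_rw [← mul_assoc]
        rw [lintegral_const_mul _ hpdf, lintegral_gaussianPDF_eq_one 0 one_ne_zero, mul_one,
          Pi.mul_apply, mul_comm]
    _ = ∫⁻ p : ℝ × ℝ, f p.1 * (gaussianPDF 0 1 p.1 * gaussianPDF 0 1 p.2) := by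
        rw [Measure.volume_eq_prod, lintegral_prod _ (by fun_prop)]
    _ = ∫⁻ p in Set.Ioi 0 ×ˢ Set.Ioo (-π) π, ENNReal.ofReal (p.1 * exp (-p.1 ^ 2 / 2)) *
          (ENNReal.ofReal (2 * π)⁻¹ * f (p.1 * cos p.2)) := by
        rw [← lintegral_comp_polarCoord_symm, polarCoord_target]
        refine setLIntegral_congr_fun (measurableSet_Ioi.prod measurableSet_Ioo) fun p hp => ?_
        have hp' : (0 : ℝ) < p.1 := hp.1
        simp only [polarCoord_symm_apply, smul_eq_mul]
        rw [gaussianPDF_mul_gaussianPDF_polar, ENNReal.ofReal_mul (by positivity),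
          ENNReal.ofReal_mul (by positivity)]
        ring
    _ = _ := by
        rw [Measure.volume_eq_prod, ← Measure.prod_restrict, lintegral_prod _ (by fun_prop)]

/-- **Box–Muller transform.** If `U₁, U₂` are independent uniform random variables on
`[0,1)`, then `√(-2 log (1 - U₁)) * cos (2 π U₂)` is standard Gaussian: the pushforward
of the product of the two uniform measures under this map is the standard Gaussian
measure. -/
theorem boxMuller_gaussian :
    Measure.map
      (fun p : ℝ × ℝ => Real.sqrt (-2 * Real.log (1 - p.1)) * Real.cos (2 * π * p.2))
      ((volume.restrict (Set.Ico 0 1)).prod (volume.restrict (Set.Ico 0 1)))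
      = gaussianReal 0 1 := by
  refine Measure.ext_of_lintegral _ fun f hf => ?_
  have hneg : (gaussianReal 0 1).map (fun x => -x) = gaussianReal 0 1 := by
    rw [gaussianReal_map_neg, neg_zero]
  rw [lintegral_map hf (by fun_prop), lintegral_prod _ (by fun_prop),
    ← restrict_Ioo_eq_restrict_Ico,
    setLIntegral_comp_sqrt_neg_two_mul_log
      (fun r => ∫⁻ u in Set.Ioo 0 1, f (r * cos (2 * π * u))),
    ← hneg, lintegral_map hf measurable_neg,
    lintegral_gaussianReal_eq_polar (f := fun x => f (-x)) (by fun_prop)]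
  refine lintegral_congr fun r => ?_
  rw [lintegral_const_mul' _ _ ENNReal.ofReal_ne_top,
    lintegral_const_mul' _ _ ENNReal.ofReal_ne_top, setLIntegral_Ioo_neg_pi_pi, ← mul_assoc
      (ENNReal.ofReal (2 * π)⁻¹), ← ENNReal.ofReal_mul (by positivity),
    inv_mul_cancel₀ (by positivity), ENNReal.ofReal_one, one_mul]
  simp only [cos_sub_pi, mul_neg, neg_neg]
end
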